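/- Let R be a commutative ring with identity, M a comorphic R-module of finite length, and S a multiplicatively closed subset of R. Then the localization S⁻¹M is a comorphic S⁻¹R-module. -/

import Mathlib

open Pointwise

/-- A proper submodule `L` of a module is completely irreducible if whenever `L` is the
intersection of a family of submodules, it equals one of them. -/
def CompletelyIrreducible {R M : Type*} [CommRing R] [AddCommGroup M] [Module R M]
    (L : Submodule R M) : Prop :=
  L ≠ ⊤ ∧ ∀ S : Set (Submodule R M), L = sInf S → L ∈ S

/-- `M` is a comorphic `R`-module if every completely irreducible submodule `L`
satisfies `L = aM` and `(L :_R M) = Ra + Ann_R(M)` for some `a ∈ R`. -/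
def Comorphic (R M : Type*) [CommRing R] [AddCommGroup M] [Module R M] : Prop :=
  ∀ L : Submodule R M, CompletelyIrreducible L →
    ∃ a : R, L = a • (⊤ : Submodule R M) ∧
      L.colon ⊤ = Ideal.span {a} + (⊤ : Submodule R M).annihilator

namespace CompletelyIrreducible

variable {R M : Type*} [CommRing R] [AddCommGroup M] [Module R M]

theorem exists_eq_of_eq_finset_inf {L : Submodule R M} (hL : CompletelyIrreducible L) {ι : Type*}
    (t : Finset ι) (g : ι → Submodule R M) (h : L = t.inf g) : ∃ i ∈ t, g i = L := by
  have hmem := hL.2 (g '' t) (by rw [h, Finset.inf_eq_sInf_image])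
  simpa using hmem

/-- Completely irreducible submodules of a localization of an Artinian module contract to
completely irreducible submodules. -/
theorem comap [IsArtinian R M] {A N : Type*} [CommRing A] [AddCommGroup N] [Algebra R A]
    [Module R N] [Module A N] [IsScalarTower R A N] (S : Submonoid R) [IsLocalization S A]
    (f : M →ₗ[R] N) [IsLocalizedModule S f] {L : Submodule A N} (hL : CompletelyIrreducible L) :
    CompletelyIrreducible ((L.restrictScalars R).comap f) := by
  let gi := Submodule.localized'gi A S f
  refine ⟨fun h ↦ hL.1 ?_, fun F hF ↦ ?_⟩
  · exact gi.u_injective (h.trans gi.gc.u_top.symm)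
  · obtain ⟨t, ht⟩ := Finset.exists_inf_le (Subtype.val : F → Submodule R M)
    have hinf : (L.restrictScalars R).comap f = t.inf Subtype.val := by
      refine le_antisymm ?_ ?_
      · rw [hF]
        exact Finset.le_inf fun i _ ↦ sInf_le i.2
      · rw [hF]
        exact le_sInf fun K hK ↦ ht ⟨K, hK⟩
    have hloc : L = t.inf fun i ↦ i.1.localized' A S f := by
      rw [← gi.l_u_eq L, hinf, ← Submodule.IsLocalizedModule.localized'FrameHom_apply, map_finset_inf]
      rfl
    obtain ⟨K, -, hK⟩ := hL.exists_eq_of_eq_finset_inf t _ hloc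
    have hKL : K.1 = (L.restrictScalars R).comap f :=
      le_antisymm (gi.gc.le_u hK.le) (hF.trans_le (sInf_le K.2))
    exact hKL ▸ K.2

end CompletelyIrreducible

theorem comorphic_localization {R M : Type*} [CommRing R] [AddCommGroup M] [Module R M]
    (hlen : IsFiniteLength R M) (hM : Comorphic R M) (S : Submonoid R) :
    Comorphic (Localization S) (LocalizedModule S M) := by
  intro L hL
  have : IsArtinian R M := (isFiniteLength_iff_isNoetherian_isArtinian.mp hlen).2
  let f := LocalizedModule.mkLinearMap S M
  obtain ⟨a, ha, hcolon⟩ := hM _ (hL.comap S f)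
  have hle : algebraMap R (Localization S) a • (⊤ : Submodule (Localization S) _) ≤ L := by
    rintro _ ⟨x, -, rfl⟩
    obtain ⟨⟨m, s⟩, rfl⟩ := IsLocalizedModule.mk'_surjective S f x
    have hm : a • m ∈ (L.restrictScalars R).comap f :=
      ha ▸ Submodule.smul_mem_pointwise_smul m a ⊤ trivial
    have hmk := L.smul_mem (IsLocalization.mk' (Localization S) 1 s) hm
    rw [← IsLocalizedModule.mk'_one S f, IsLocalizedModule.mk'_smul_mk'] at hmk
    simpa [algebraMap_smul, IsLocalizedModule.mk'_smul] using hmk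
  refine ⟨algebraMap R _ a, le_antisymm (fun x hx ↦ ?_) hle, le_antisymm (fun r hr ↦ ?_) ?_⟩
  · obtain ⟨m, hm, s, rfl⟩ := (Submodule.localized'gi (Localization S) S f).le_l_u L hx
    rw [ha] at hm
    obtain ⟨m, -, rfl⟩ := hm
    refine ⟨IsLocalizedModule.mk' f m s, trivial, ?_⟩
    simp [algebraMap_smul, IsLocalizedModule.mk'_smul]
  · obtain ⟨r, s, rfl⟩ := IsLocalization.exists_mk'_eq S r
    have hr' : r ∈ ((L.restrictScalars R).comap f).colon ⊤ := by
      refine Submodule.mem_colon.mpr fun m _ ↦ ?_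
      have := L.smul_mem (algebraMap R _ (s : R)) (Submodule.mem_colon.mp hr (f m) trivial)
      rw [smul_smul, IsLocalization.mk'_spec', algebraMap_smul, ← map_smul] at this
      exact this
    rw [hcolon] at hr'
    obtain ⟨b, hb, c, hc, rfl⟩ := Submodule.mem_sup.mp hr'
    obtain ⟨d, rfl⟩ := Ideal.mem_span_singleton'.mp hb
    rw [IsLocalization.mk'_eq_mul_mk'_one, mul_comm]
    refine Ideal.mul_mem_left _ _ ?_
    rw [map_add, map_mul]
    refine Submodule.add_mem_sup (Ideal.mem_span_singleton'.mpr ⟨_, rfl⟩) ?_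
    refine Submodule.mem_annihilator.mpr fun x _ ↦ ?_
    obtain ⟨⟨m, t⟩, rfl⟩ := IsLocalizedModule.mk'_surjective S f x
    have hcm := Submodule.mem_annihilator.mp hc m trivial
    simp [algebraMap_smul, ← IsLocalizedModule.mk'_smul, hcm]
  · refine sup_le ((Ideal.span_singleton_le_iff_mem _).mpr ?_) fun r hr ↦ ?_
    · exact Submodule.mem_colon.mpr fun x _ ↦
        hle (Submodule.smul_mem_pointwise_smul x _ ⊤ trivial)
    · refine Submodule.mem_colon.mpr fun x _ ↦ ?_
      rw [Submodule.mem_annihilator.mp hr x trivial]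
      exact L.zero_mem
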